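/- For every integer n ≥ 2, the number of foot-sortable alignment-free 2-uniform sock orderings of length 2n is exactly (n−1)·F_{n+1}, where (F_k) denotes the Fibonacci sequence with F_1 = F_2 = 1 and F_k = F_{k−1} + F_{k−2}. -/

import Mathlib

/-- Two words represent the same sock ordering iff they have the same length and the
same pattern of letter equalities. -/
def SockEquiv (w v : List ℕ) : Prop :=
  w.length = v.length ∧ ∀ i j, i < w.length → j < w.length →
    (w.getD i 0 = w.getD j 0 ↔ v.getD i 0 = v.getD j 0)

theorem sockEquiv_refl (w : List ℕ) : SockEquiv w w :=
  ⟨rfl, fun _ _ _ _ => Iff.rfl⟩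

theorem sockEquiv_symm {w v : List ℕ} (h : SockEquiv w v) : SockEquiv v w := by
  obtain ⟨hl, he⟩ := h
  exact ⟨hl.symm, fun i j hi hj => (he i j (by omega) (by omega)).symm⟩

theorem sockEquiv_trans {u v w : List ℕ} (h1 : SockEquiv u v) (h2 : SockEquiv v w) :
    SockEquiv u w := by
  obtain ⟨hl1, he1⟩ := h1
  obtain ⟨hl2, he2⟩ := h2
  exact ⟨hl1.trans hl2, fun i j hi hj =>
    (he1 i j hi hj).trans (he2 i j (by omega) (by omega))⟩

instance sockSetoid : Setoid (List ℕ) :=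
  ⟨SockEquiv, ⟨sockEquiv_refl, sockEquiv_symm, sockEquiv_trans⟩⟩

/-- A sock ordering is an equivalence class of words. -/
def SockOrdering : Type := Quotient sockSetoid

/-- The length of a sock ordering. -/
def SockOrdering.length : SockOrdering → ℕ :=
  Quotient.lift List.length fun _ _ h => h.1

/-- One step of the (nondeterministic) one-stack (one-foot) sorting procedure, acting on
(input, stack, output) triples: push the leftmost input letter onto the stack, or pop
the top letter of the stack onto the right end of the output. -/
inductive StackStep : List ℕ × List ℕ × List ℕ → List ℕ × List ℕ × List ℕ → Prop
  | push (a : ℕ) (inp st out : List ℕ) :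
      StackStep (a :: inp, st, out) (inp, a :: st, out)
  | pop (a : ℕ) (inp st out : List ℕ) :
      StackStep (inp, a :: st, out) (inp, st, out ++ [a])

/-- `out` is obtainable from `w` by one pass through a stack. -/
def IsStackOutput (w out : List ℕ) : Prop :=
  Relation.ReflTransGen StackStep (w, [], []) ([], [], out)

/-- A word has all equal letters consecutive, i.e. it represents a sorted sock ordering. -/
def SortedWordSock (w : List ℕ) : Prop :=
  ∀ i j k, i < j → j < k → k < w.length →
    w.getD i 0 = w.getD k 0 → w.getD i 0 = w.getD j 0

/-- A sock ordering is sorted if some (equivalently, every) word representing it has all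
equal letters consecutive. -/
def SockOrdering.IsSorted (ρ : SockOrdering) : Prop :=
  ∃ w : List ℕ, (⟦w⟧ : SockOrdering) = ρ ∧ SortedWordSock w

/-- `foot ρ` is the set of sock orderings represented by the outputs obtainable by
one pass of foot-sorting applied to a word representing `ρ`. -/
def foot (ρ : SockOrdering) : Set SockOrdering :=
  {κ | ∃ w out : List ℕ, (⟦w⟧ : SockOrdering) = ρ ∧ IsStackOutput w out ∧
    (⟦out⟧ : SockOrdering) = κ}

/-- Iterated foot-sorting: `footIter 0 ρ = {ρ}` and
`footIter (t+1) ρ = ⋃ κ ∈ footIter t ρ, foot κ`. -/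
def footIter : ℕ → SockOrdering → Set SockOrdering
  | 0, ρ => {ρ}
  | t + 1, ρ => ⋃ κ ∈ footIter t ρ, foot κ

/-- A sock ordering is `t`-foot-sortable if `foot^t ρ` contains a sorted sock ordering. -/
def FootSortable (t : ℕ) (ρ : SockOrdering) : Prop :=
  ∃ κ ∈ footIter t ρ, κ.IsSorted

/-- `ρ` has exactly `n` colors. -/
def HasColors (ρ : SockOrdering) (n : ℕ) : Prop :=
  ∃ w : List ℕ, (⟦w⟧ : SockOrdering) = ρ ∧ w.toFinset.card = n

/-- `ρ` is `r`-uniform: every color appears exactly `r` times. -/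
def RUniform (r : ℕ) (ρ : SockOrdering) : Prop :=
  ∃ w : List ℕ, (⟦w⟧ : SockOrdering) = ρ ∧ ∀ a ∈ w, w.count a = r

/-- `ρ` contains `ρ'` as a (sock) pattern: some word representing `ρ` has a subsequence
representing `ρ'`. -/
def Contains (ρ ρ' : SockOrdering) : Prop :=
  ∃ w u : List ℕ, (⟦w⟧ : SockOrdering) = ρ ∧ u.Sublist w ∧ (⟦u⟧ : SockOrdering) = ρ'

/-- A word is stratified with `n` colors and `r` blocks: it is the concatenation of `r`
blocks of length `n`, each containing every color exactly once. -/
def StratifiedWord (n r : ℕ) (w : List ℕ) : Prop :=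
  ∃ blocks : List (List ℕ), blocks.length = r ∧ w = blocks.flatten ∧
    ∀ b ∈ blocks, b.length = n ∧ b.Nodup ∧ b.toFinset = w.toFinset

/-- An `r`-uniform stratified sock ordering with `n` colors. -/
def IsStratified (n r : ℕ) (ρ : SockOrdering) : Prop :=
  ∃ w : List ℕ, (⟦w⟧ : SockOrdering) = ρ ∧ StratifiedWord n r w

/-- The word `σ(1) σ(2) ⋯ σ(n)` (with values written in `{1,…,n}`). -/
def permWord (n : ℕ) (σ : Equiv.Perm (Fin n)) : List ℕ :=
  (List.finRange n).map fun i => (σ i : ℕ) + 1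

/-- The word `1 2 ⋯ n σ(1) σ(2) ⋯ σ(n)` representing the alignment-free 2-uniform sock
ordering associated with `σ`. -/
def afWord (n : ℕ) (σ : Equiv.Perm (Fin n)) : List ℕ :=
  ((List.finRange n).map fun i => (i : ℕ) + 1) ++ permWord n σ

/-- A word `w` contains the (permutation) pattern `p`: some subsequence of `w` of the same
length as `p` is order-isomorphic to `p`. -/
def ContainsPattern (w p : List ℕ) : Prop :=
  ∃ s : List ℕ, s.Sublist w ∧ s.length = p.length ∧
    ∀ i j, i < s.length → j < s.length →
      (s.getD i 0 < s.getD j 0 ↔ p.getD i 0 < p.getD j 0)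

def AvoidsPattern (w p : List ℕ) : Prop := ¬ ContainsPattern w p

/-- A word avoids the permutation patterns 123, 132, and 213. -/
def Avoids123_132_213 (w : List ℕ) : Prop :=
  AvoidsPattern w [1, 2, 3] ∧ AvoidsPattern w [1, 3, 2] ∧ AvoidsPattern w [2, 1, 3]

/-- A word avoids the pattern 231: there are no indices `i < j < k` with `w k < w i < w j`. -/
def Avoids231 (w : List ℕ) : Prop :=
  ¬ ∃ i j k, i < j ∧ j < k ∧ k < w.length ∧
    w.getD k 0 < w.getD i 0 ∧ w.getD i 0 < w.getD j 0

/-- `StackRun inp st out`: starting from input `inp` and stack `st`, the stack procedure can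
emit exactly `out` and finish with both input and stack empty. -/
inductive StackRun : List ℕ → List ℕ → List ℕ → Prop
  | nil : StackRun [] [] []
  | push {a : ℕ} {inp st out : List ℕ} : StackRun inp (a :: st) out → StackRun (a :: inp) st out
  | pop {a : ℕ} {inp st out : List ℕ} : StackRun inp st out → StackRun inp (a :: st) (a :: out)

/-- A word of the form `a₁ a₁ a₂ a₂ ⋯`. -/
inductive Paired : List ℕ → Prop
  | nil : Paired []
  | cons (a : ℕ) {l : List ℕ} : Paired l → Paired (a :: a :: l)

/-- `LayeredBy D S`: the word `S` is obtained from `D` by swapping the entries of some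
pairwise disjoint pairs of adjacent positions. -/
inductive LayeredBy : List ℕ → List ℕ → Prop
  | nil : LayeredBy [] []
  | keep (a : ℕ) {D S : List ℕ} : LayeredBy D S → LayeredBy (a :: D) (a :: S)
  | swap (a b : ℕ) {D S : List ℕ} : LayeredBy D S → LayeredBy (a :: b :: D) (b :: a :: S)

/-- The words `S` with `LayeredBy D S`. -/
def layerings : List ℕ → Finset (List ℕ)
  | [] => {[]}
  | [a] => {[a]}
  | a :: b :: D =>
    (layerings (b :: D)).image (List.cons a) ∪ (layerings D).image fun S => b :: a :: S

/-- From input `S` and stack `D`, a paired output can be produced. -/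
def PairSortable (S D : List ℕ) : Prop := ∃ out, StackRun S D out ∧ Paired out

/-! ### Stack runs -/

theorem StackRun.perm {inp st out : List ℕ} (h : StackRun inp st out) :
    out.Perm (inp ++ st) := by
  induction h with
  | nil => exact List.Perm.refl _
  | push _ ih => exact ih.trans List.perm_middle
  | pop _ ih => exact (ih.cons _).trans List.perm_middle.symm

theorem isStackOutput_iff_stackRun {w out : List ℕ} :
    IsStackOutput w out ↔ StackRun w [] out := by
  constructor
  · intro h
    suffices H : ∀ x, Relation.ReflTransGen StackStep x ([], [], out) →
        ∃ o, out = x.2.2 ++ o ∧ StackRun x.1 x.2.1 o by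
      obtain ⟨o, ho, hr⟩ := H _ h
      simp only [List.nil_append] at ho
      exact ho ▸ hr
    intro x hx
    induction hx using Relation.ReflTransGen.head_induction_on with
    | refl => exact ⟨[], by simp, .nil⟩
    | head hstep _ ih =>
      obtain ⟨o, ho, hr⟩ := ih
      cases hstep with
      | push a inp st out' => exact ⟨o, ho, .push hr⟩
      | pop a inp st out' => exact ⟨a :: o, by simpa using ho, .pop hr⟩
  · intro h
    suffices H : ∀ {inp st o}, StackRun inp st o → ∀ o',
        Relation.ReflTransGen StackStep (inp, st, o') ([], [], o' ++ o) by
      exact H h []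
    intro inp st o hr
    induction hr with
    | nil => intro o'; simpa using Relation.ReflTransGen.refl
    | push _ ih => exact fun o' => .head (.push _ _ _ _) (ih o')
    | @pop a _ _ _ _ ih =>
      exact fun o' => .head (.pop _ _ _ _) (by simpa using ih (o' ++ [a]))

theorem StackRun.map (f : ℕ → ℕ) {inp st out : List ℕ} (h : StackRun inp st out) :
    StackRun (inp.map f) (st.map f) (out.map f) := by
  induction h with
  | nil => exact .nil
  | push _ ih => exact .push ih
  | pop _ ih => exact .pop ih

theorem StackRun.push_all {U s D o : List ℕ} (h : StackRun s (U.reverse ++ D) o) :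
    StackRun (U ++ s) D o := by
  induction U generalizing D with
  | nil => simpa using h
  | cons u U ih => exact .push (ih (by simpa using h))

/-- If the next output letter occurs neither in `U` nor on the stack, then all of `U` must be
pushed first. -/
theorem StackRun.pushed_of_notMem {U s D o : List ℕ} {a : ℕ} (h : StackRun (U ++ s) D (a :: o))
    (hU : a ∉ U) (hD : a ∉ D) : StackRun s (U.reverse ++ D) (a :: o) := by
  induction U generalizing D with
  | nil => simpa using h
  | cons u U ih =>
    simp only [List.mem_cons, not_or] at hU
    cases h with
    | push h => simpa using ih h hU.2 (by simp [hU.1, hD])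
    | pop h => simp at hD

/-- Splitting a run at the moment when a given stack entry is popped. -/
theorem StackRun.exists_split {inp st out T B : List ℕ} {x : ℕ} (h : StackRun inp st out)
    (hst : st = T ++ x :: B) :
    ∃ o₁ o₂ i₁ i₂, inp = i₁ ++ i₂ ∧ out = o₁ ++ x :: o₂ ∧ o₁ ⊆ T ++ i₁ ∧ StackRun i₂ B o₂ := by
  induction h generalizing T with
  | nil => simp at hst
  | @push a inp st out _ ih =>
    obtain ⟨o₁, o₂, i₁, i₂, h1, h2, h3, h4⟩ := ih (T := a :: T) (by simp [hst])
    refine ⟨o₁, o₂, a :: i₁, i₂, by simp [h1], h2, fun z hz => ?_, h4⟩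
    have := h3 hz
    simp only [List.mem_append, List.mem_cons] at this ⊢
    tauto
  | @pop a inp st out h ih =>
    cases T with
    | nil =>
      obtain ⟨rfl, rfl⟩ := List.cons.inj hst
      exact ⟨[], out, [], inp, rfl, rfl, by simp, h⟩
    | cons t T =>
      obtain ⟨rfl, hst'⟩ := List.cons.inj hst
      obtain ⟨o₁, o₂, i₁, i₂, h1, h2, h3, h4⟩ := ih hst'
      exact ⟨a :: o₁, o₂, i₁, i₂, h1, by simp [h2],
        by simpa using List.subset_cons_of_subset a h3, h4⟩

theorem StackRun.exists_cons {inp B out : List ℕ} {y : ℕ} (h : StackRun inp (y :: B) out) :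
    ∃ z o, out = z :: o ∧ (z = y ∨ z ∈ inp) := by
  generalize hst : y :: B = st at h
  induction h generalizing y B with
  | nil => simp at hst
  | push _ ih =>
    obtain ⟨z, o, h1, h2⟩ := ih rfl
    exact ⟨z, o, h1, by simp [h2]⟩
  | pop _ _ =>
    obtain ⟨rfl, rfl⟩ := List.cons.inj hst
    exact ⟨_, _, rfl, .inl rfl⟩

theorem Paired.eq_cons_of_notMem {l o₁ o₂ : List ℕ} {x : ℕ} (h : Paired l)
    (hl : l = o₁ ++ x :: o₂) (hx : x ∉ o₁) : ∃ o, o₂ = x :: o := by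
  induction h generalizing o₁ with
  | nil => simp at hl
  | cons a _ ih =>
    match o₁ with
    | [] => simp at hl; exact ⟨_, by rw [← hl.2, hl.1]⟩
    | [b] => simp at hl hx; exact absurd (hl.2.1.symm.trans hl.1) hx
    | b :: c :: o₁ =>
      simp at hl hx
      exact ih hl.2.2 hx.2.2

/-- A letter whose last copy lies on the stack directly above a different letter obstructs
pairing. -/
theorem not_paired_of_blocked {inp B out o₀ : List ℕ} {x y : ℕ}
    (h : StackRun inp (x :: y :: B) out) (hinp : x ∉ inp) (ho : x ∉ o₀) (hxy : x ≠ y) :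
    ¬ Paired (o₀ ++ out) := by
  intro hp
  obtain ⟨o₁, o₂, i₁, i₂, rfl, rfl, h3, h4⟩ := h.exists_split (T := []) rfl
  simp only [List.mem_append, not_or] at hinp
  obtain ⟨o, rfl⟩ := hp.eq_cons_of_notMem (o₁ := o₀ ++ o₁) (o₂ := o₂) (x := x) (by simp)
    (by simp only [List.mem_append, not_or]; exact ⟨ho, fun hz => hinp.1 (by simpa using h3 hz)⟩)
  obtain ⟨z, o', h5, h6⟩ := h4.exists_cons
  obtain ⟨rfl, -⟩ := List.cons.inj h5
  exact h6.elim hxy hinp.2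

theorem StackRun.pop_of_paired {S D o o₀ : List ℕ} {x : ℕ} (h : StackRun S (x :: D) o)
    (hp : Paired (o₀ ++ o)) (hS : S.Nodup) (hx : x ∉ S) (ho : ∀ z ∈ o₀, z ∉ S) :
    ∃ o', o = x :: o' ∧ StackRun S D o' := by
  cases h with
  | pop h => exact ⟨_, rfl, h⟩
  | @push z S' _ _ h =>
    simp only [List.mem_cons, not_or, List.nodup_cons] at hx hS ho
    exact absurd hp (not_paired_of_blocked h hS.1 (fun hz => (ho z hz).1 rfl) (Ne.symm hx.1))

theorem pairSortable_of_double {S D o : List ℕ} {x : ℕ} (h : StackRun S (x :: x :: D) o)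
    (hp : Paired o) (hS : S.Nodup) (hx : x ∉ S) : PairSortable S D := by
  obtain ⟨o', rfl, h'⟩ := h.pop_of_paired (o₀ := []) hp hS hx (by simp)
  obtain ⟨o'', rfl, h''⟩ := h'.pop_of_paired (o₀ := [x]) hp hS hx (by simpa using hx)
  cases hp with
  | cons _ hp => exact ⟨o'', h'', hp⟩

/-- The state after one copy of `a` has been emitted and another one is needed next. -/
theorem cases_of_stackRun_cons {s F o : List ℕ} {a : ℕ} (h : StackRun s F (a :: o))
    (hp : Paired o) (hs : s.Nodup) (hperm : s.Perm (a :: F)) (haF : a ∉ F) :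
    (∃ s', s = a :: s' ∧ PairSortable s' F) ∨
      ∃ x F' s', F = x :: F' ∧ s = x :: a :: s' ∧ PairSortable s' F' := by
  have hp' : Paired (a :: a :: o) := .cons a hp
  cases h with
  | pop h => simp at haF
  | @push x s' _ _ h =>
    rw [List.nodup_cons] at hs
    by_cases hxa : x = a
    · subst hxa
      obtain ⟨o', ho', h'⟩ := h.pop_of_paired (o₀ := [x]) hp' hs.2 hs.1 (by simpa using hs.1)
      obtain ⟨-, rfl⟩ := List.cons.inj ho'
      exact .inl ⟨s', rfl, o, h', hp⟩
    · cases h with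
      | pop h => exact absurd rfl hxa
      | @push t s'' _ _ h =>
        rw [List.nodup_cons, List.mem_cons, not_or] at hs
        by_cases hta : t = a
        · subst hta
          obtain ⟨o', ho', h'⟩ := h.pop_of_paired (o₀ := [t]) hp' hs.2.2 hs.2.1
            (by simpa using hs.2.1)
          obtain ⟨-, rfl⟩ := List.cons.inj ho'
          have hxF : x ∈ F := by
            have := hperm.subset (List.mem_cons_self)
            simpa [hxa] using this
          cases F with
          | nil => simp at hxF
          | cons y F' =>
            by_cases hxy : x = y
            · subst hxy
              exact .inr ⟨x, F', s'', rfl, rfl, pairSortable_of_double h' hp hs.2.2 hs.1.2⟩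
            · exact absurd hp (not_paired_of_blocked (o₀ := []) h' hs.1.2 (by simp) hxy)
        · exact absurd hp' (not_paired_of_blocked (o₀ := [a]) h hs.2.1 (by simpa using hta)
            (Ne.symm hs.1.1))

theorem pairSortable_of_layeredBy {D S : List ℕ} (h : LayeredBy D S) : PairSortable S D := by
  induction h with
  | nil => exact ⟨[], .nil, .nil⟩
  | keep a _ ih =>
    obtain ⟨o, h, hp⟩ := ih
    exact ⟨_, .push (.pop (.pop h)), .cons a hp⟩
  | swap a b _ ih =>
    obtain ⟨o, h, hp⟩ := ih
    exact ⟨_, .pop (.push (.push (.pop (.pop (.pop h))))), .cons a (.cons b hp)⟩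

theorem layeredBy_of_pairSortable : ∀ {D S : List ℕ}, D.Nodup → S.Perm D → PairSortable S D →
    LayeredBy D S
  | [], S, _, hperm, _ => by rw [hperm.eq_nil]; exact .nil
  | m :: D, S, hD, hperm, ⟨out, h, hp⟩ => by
    have hS : S.Nodup := hperm.nodup_iff.mpr hD
    have hD' := List.nodup_cons.mp hD
    cases h with
    | @push s S' _ _ h =>
      have hS' := List.nodup_cons.mp hS
      by_cases hsm : s = m
      · subst hsm
        exact .keep s (layeredBy_of_pairSortable hD'.2 hperm.cons_inv
          (pairSortable_of_double h hp hS'.2 hS'.1))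
      · exact absurd hp (not_paired_of_blocked (o₀ := []) h hS'.1 (by simp) hsm)
    | @pop _ _ _ out h =>
      obtain ⟨o, rfl⟩ := hp.eq_cons_of_notMem (o₁ := []) rfl (by simp)
      cases hp with
      | cons _ hp =>
      obtain ⟨s', rfl, hps⟩ | ⟨x, F', s', rfl, rfl, hps⟩ :=
        cases_of_stackRun_cons h hp hS hperm hD'.1
      · exact .keep m (layeredBy_of_pairSortable hD'.2 hperm.cons_inv hps)
      · exact .swap m x (layeredBy_of_pairSortable (List.nodup_cons.mp hD'.2).2
          ((List.Perm.swap _ _ _).trans hperm).cons_inv.cons_inv hps)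
termination_by D => D.length

theorem LayeredBy.perm {D S : List ℕ} (h : LayeredBy D S) : S.Perm D := by
  induction h with
  | nil => exact .nil
  | keep a _ ih => exact ih.cons a
  | swap a b _ ih => exact (List.Perm.swap _ _ _).trans ((ih.cons b).cons a)

/-! ### The first half of the word -/

theorem exists_stackRun_cons {U s D out : List ℕ} (h : StackRun (U ++ s) D out)
    (hp : Paired out) (hne : U.reverse ++ D ≠ []) (hnd : (U.reverse ++ D).Nodup)
    (hs : s.Nodup) :
    ∃ a ∈ U.reverse ++ D, ∃ o, StackRun s ((U.reverse ++ D).erase a) (a :: o) ∧ Paired o := by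
  induction U generalizing D with
  | nil =>
    simp only [List.reverse_nil, List.nil_append] at *
    cases h with
    | nil => simp at hne
    | @pop a inp D out h =>
      obtain ⟨o, rfl⟩ := hp.eq_cons_of_notMem (o₁ := []) rfl (by simp)
      cases hp with
      | cons _ hp => exact ⟨a, by simp, o, by simpa using h, hp⟩
    | @push x s' _ _ h =>
      rw [List.nodup_cons] at hs
      cases D with
      | nil => simp at hne
      | cons y D =>
        by_cases hxy : x = y
        · subst hxy
          obtain ⟨o, h', hp'⟩ := pairSortable_of_double h hp hs.2 hs.1
          exact ⟨x, by simp, o, by simpa using .push (.pop h'), hp'⟩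
        · exact absurd hp (not_paired_of_blocked (o₀ := []) h hs.1 (by simp) hxy)
  | cons u U ih =>
    cases h with
    | push h => simpa using ih h (by simp) (by simpa using hnd)
    | @pop a _ D out h =>
      obtain ⟨o, rfl⟩ := hp.eq_cons_of_notMem (o₁ := []) rfl (by simp)
      cases hp with
      | cons _ hp =>
      have hnd' := List.nodup_middle.mp hnd
      rw [List.nodup_cons, List.mem_append, not_or, List.mem_reverse] at hnd'
      have := StackRun.pushed_of_notMem (U := u :: U) h hnd'.1.1 hnd'.1.2
      refine ⟨a, by simp, o, ?_, hp⟩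
      rw [List.erase_append_right _ (by simpa only [List.mem_reverse] using hnd'.1.1)]
      simpa using this

theorem pairSortable_append_reverse {E s : List ℕ} {a : ℕ} (ha : a ∈ E) {o : List ℕ}
    (h : StackRun s (E.erase a) (a :: o)) (hp : Paired o) :
    PairSortable (E.reverse ++ s) [] := by
  obtain ⟨A, B, hA, rfl, he⟩ := List.exists_erase_eq ha
  refine ⟨a :: a :: o, ?_, .cons a hp⟩
  rw [he] at h
  have h1 : StackRun (A.reverse ++ s) B (a :: o) := .push_all (by simpa using h)
  have h2 : StackRun (B.reverse ++ (a :: (A.reverse ++ s))) [] (a :: a :: o) :=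
    .push_all (by simpa using .push (.pop h1))
  simpa using h2

/-- The words `s` for which `E.reverse ++ s` can be sorted. -/
def GoodWord (E s : List ℕ) : Prop :=
  ∃ a ∈ E, (∃ s', s = a :: s' ∧ LayeredBy (E.erase a) s') ∨
    ∃ x F' s', E.erase a = x :: F' ∧ s = x :: a :: s' ∧ LayeredBy F' s'

theorem GoodWord.perm {E s : List ℕ} (h : GoodWord E s) : s.Perm E := by
  obtain ⟨a, ha, ⟨s', rfl, hl⟩ | ⟨x, F', s', hE, rfl, hl⟩⟩ := h
  · exact (hl.perm.cons a).trans (List.perm_cons_erase ha).symm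
  · refine (List.Perm.swap _ _ _).trans (List.Perm.trans ?_ (List.perm_cons_erase ha).symm)
    rw [hE]
    exact (hl.perm.cons x).cons a

theorem pairSortable_iff_goodWord {E s : List ℕ} (hE : E.Nodup) (hne : E ≠ [])
    (hperm : s.Perm E) : PairSortable (E.reverse ++ s) [] ↔ GoodWord E s := by
  have hs : s.Nodup := hperm.nodup_iff.mpr hE
  constructor
  · rintro ⟨out, h, hp⟩
    obtain ⟨a, ha, o, h', hp'⟩ :=
      exists_stackRun_cons h hp (by simpa using hne) (by simpa using hE) hs
    simp only [List.reverse_reverse, List.append_nil] at ha h'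
    have hnd : (E.erase a).Nodup := hE.erase a
    have hperm' : s.Perm (a :: E.erase a) := hperm.trans (List.perm_cons_erase ha)
    refine ⟨a, ha, ?_⟩
    obtain ⟨s', rfl, hps⟩ | ⟨x, F', s', hF, rfl, hps⟩ :=
      cases_of_stackRun_cons h' hp' hs hperm' hE.not_mem_erase
    · exact .inl ⟨s', rfl, layeredBy_of_pairSortable hnd hperm'.cons_inv hps⟩
    · rw [hF] at hperm' hnd
      exact .inr ⟨x, F', s', hF, rfl, layeredBy_of_pairSortable (List.nodup_cons.mp hnd).2
          ((List.Perm.swap _ _ _).trans hperm').cons_inv.cons_inv hps⟩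
  · rintro ⟨a, ha, ⟨s', rfl, hl⟩ | ⟨x, F', s', hF, rfl, hl⟩⟩
    · obtain ⟨o, h, hp⟩ := pairSortable_of_layeredBy hl
      exact pairSortable_append_reverse ha (.push (.pop h)) hp
    · obtain ⟨o, h, hp⟩ := pairSortable_of_layeredBy hl
      refine pairSortable_append_reverse ha (o := x :: x :: o) ?_ (.cons x hp)
      rw [hF]
      exact .push (.push (.pop (.pop (.pop h))))

/-! ### Sorted words -/

theorem SortedWordSock.tail {a : ℕ} {l : List ℕ} (h : SortedWordSock (a :: l)) :
    SortedWordSock l := fun i j k hij hjk hk he => by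
  simpa using h (i + 1) (j + 1) (k + 1) (by omega) (by omega) (by simpa using hk)
    (by simpa using he)

theorem paired_of_sortedWordSock : ∀ {l : List ℕ}, SortedWordSock l →
    (∀ a ∈ l, l.count a = 2) → Paired l
  | [], _, _ => .nil
  | [a], _, hc => by simpa using hc a
  | a :: b :: l, h, hc => by
    have hab : a = b := by
      by_contra hab
      have h1 := hc a (by simp)
      have h2 : a ∈ l := by
        rw [List.count_cons_self, List.count_cons_of_ne (Ne.symm hab)] at h1
        exact List.count_pos_iff.mp (by omega)
      obtain ⟨k, hk, rfl⟩ := List.getElem_of_mem h2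
      exact hab (h 0 1 (k + 2) (by omega) (by omega) (by simpa using hk) (by simp [hk]))
    subst hab
    have ha : a ∉ l := by
      have h1 := hc a (by simp)
      simp only [List.count_cons_self] at h1
      exact List.count_eq_zero.mp (by omega)
    refine .cons a (paired_of_sortedWordSock h.tail.tail fun c hc' => ?_)
    have hca : a ≠ c := fun hh => ha (hh ▸ hc')
    have := hc c (by simp [hc'])
    rwa [List.count_cons_of_ne hca, List.count_cons_of_ne hca] at this

theorem Paired.sortedWordSock {l : List ℕ} (h : Paired l) (hc : ∀ a ∈ l, l.count a = 2) :
    SortedWordSock l := by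
  induction h with
  | nil => intro i j k _ _ hk; simp at hk
  | @cons a l _ ih =>
    have ha : a ∉ l := by
      have h1 := hc a (by simp)
      simp only [List.count_cons_self] at h1
      exact List.count_eq_zero.mp (by omega)
    have hs : SortedWordSock l := ih fun c hc' => by
      have hca : a ≠ c := fun hh => ha (hh ▸ hc')
      have := hc c (by simp [hc'])
      rwa [List.count_cons_of_ne hca, List.count_cons_of_ne hca] at this
    intro i j k hij hjk hk he
    obtain ⟨k, rfl⟩ : ∃ k', k = k' + 2 := ⟨k - 2, by omega⟩
    have hk' : k < l.length := by simpa using hk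
    have hmem : l.getD k 0 ∈ l := by simp [hk']
    match i, j with
    | 0, _ =>
      simp only [List.getD_cons_zero, List.getD_cons_succ] at he
      exact absurd (he ▸ hmem) ha
    | 1, _ =>
      simp only [List.getD_cons_zero, List.getD_cons_succ] at he
      exact absurd (he ▸ hmem) ha
    | i + 2, 0 => omega
    | i + 2, 1 => omega
    | i + 2, j + 2 =>
      simp only [List.getD_cons_succ] at he ⊢
      exact hs i j k (by omega) (by omega) hk' he

theorem SortedWordSock.congr {w v : List ℕ} (h : SockEquiv w v) (hw : SortedWordSock w) :
    SortedWordSock v := by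
  obtain ⟨hl, he⟩ := h
  intro i j k hij hjk hk hik
  rw [← he i j (by omega) (by omega)]
  exact hw i j k hij hjk (by omega) ((he i k (by omega) (by omega)).mpr hik)

theorem SockEquiv.exists_map {w v : List ℕ} (h : SockEquiv w v) :
    ∃ f : ℕ → ℕ, Set.InjOn f {x | x ∈ w} ∧ w.map f = v := by
  obtain ⟨hl, he⟩ := h
  have key : ∀ i (hi : i < w.length), v.getD (w.idxOf w[i]) 0 = v.getD i 0 := by
    intro i hi
    have hlt : w.idxOf w[i] < w.length := List.idxOf_lt_length_iff.mpr (List.getElem_mem hi)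
    rw [← he _ _ hlt hi]
    simp [hlt, hi]
  refine ⟨fun x => v.getD (w.idxOf x) 0, ?_, ?_⟩
  · intro x hx y hy hxy
    obtain ⟨i, hi, rfl⟩ := List.getElem_of_mem hx
    obtain ⟨j, hj, rfl⟩ := List.getElem_of_mem hy
    simp only [key] at hxy
    have := (he i j hi hj).mpr hxy
    simpa [hi, hj] using this
  · apply List.ext_getElem (by simpa using hl)
    intro i h1 h2
    have := key i (by simpa using h1)
    rw [List.getElem_map, this, List.getD_eq_getElem _ _ h2]

theorem sockEquiv_map {f : ℕ → ℕ} {w : List ℕ} (hf : Set.InjOn f {x | x ∈ w}) :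
    SockEquiv w (w.map f) := by
  refine ⟨by simp, fun i j hi hj => ?_⟩
  simp only [List.getD_eq_getElem, List.length_map, hi, hj, List.getElem_map]
  exact (hf.eq_iff (List.getElem_mem hi) (List.getElem_mem hj)).symm

theorem footSortable_one_iff {w : List ℕ} :
    FootSortable 1 (⟦w⟧ : SockOrdering) ↔ ∃ out, StackRun w [] out ∧ SortedWordSock out := by
  have hiter (ρ : SockOrdering) : FootSortable 1 ρ ↔ ∃ κ ∈ foot ρ, κ.IsSorted := by
    simp [FootSortable, footIter]
  refine (hiter _).trans ?_
  constructor
  · rintro ⟨κ, ⟨w', out, hw, hout, rfl⟩, v, hv, hsort⟩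
    have hrun := isStackOutput_iff_stackRun.mp hout
    have hw' : SockEquiv w' w := Quotient.exact hw
    have hv' : SockEquiv v out := Quotient.exact hv
    obtain ⟨f, hf, rfl⟩ := hw'.exists_map
    refine ⟨out.map f, by simpa using hrun.map f, (hsort.congr hv').congr (sockEquiv_map ?_)⟩
    exact hf.mono fun x hx => by simpa using hrun.perm.subset hx
  · rintro ⟨out, h, hs⟩
    exact ⟨⟦out⟧, ⟨w, out, rfl, isStackOutput_iff_stackRun.mpr h, rfl⟩, out, rfl, hs⟩

theorem footSortable_one_iff_pairSortable {w : List ℕ} (hw : ∀ a ∈ w, w.count a = 2) :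
    FootSortable 1 (⟦w⟧ : SockOrdering) ↔ PairSortable w [] := by
  rw [footSortable_one_iff]
  refine exists_congr fun out => and_congr_right fun h => ?_
  have hperm : out.Perm w := by simpa using h.perm
  have hc : ∀ a ∈ out, out.count a = 2 := fun a ha => by
    rw [hperm.count_eq]; exact hw a (hperm.subset ha)
  exact ⟨fun hs => paired_of_sortedWordSock hs hc, fun hp => hp.sortedWordSock hc⟩

/-! ### Alignment-free words -/

theorem nodup_permWord (n : ℕ) (σ : Equiv.Perm (Fin n)) : (permWord n σ).Nodup :=
  (List.nodup_finRange n).map fun _ _ h => σ.injective (Fin.ext (Nat.succ_injective h))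

theorem afWord_eq (n : ℕ) (σ : Equiv.Perm (Fin n)) :
    afWord n σ = permWord n 1 ++ permWord n σ := by
  simp [afWord, permWord, ← List.map_eq_flatMap, -List.map_coe_finRange_eq_range]

theorem length_permWord (n : ℕ) (σ : Equiv.Perm (Fin n)) : (permWord n σ).length = n := by
  simp [permWord]

theorem mem_permWord {n : ℕ} {σ : Equiv.Perm (Fin n)} {a : ℕ} :
    a ∈ permWord n σ ↔ 1 ≤ a ∧ a ≤ n := by
  simp only [permWord, List.mem_map, List.mem_finRange, true_and]
  constructor
  · rintro ⟨i, rfl⟩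
    exact ⟨by omega, (σ i).isLt⟩
  · rintro ⟨h1, h2⟩
    exact ⟨σ.symm ⟨a - 1, by omega⟩, by simp; omega⟩

theorem permWord_perm (n : ℕ) (σ τ : Equiv.Perm (Fin n)) :
    (permWord n σ).Perm (permWord n τ) :=
  (List.perm_ext_iff_of_nodup (nodup_permWord n σ) (nodup_permWord n τ)).mpr
    fun _ => by rw [mem_permWord, mem_permWord]

theorem permWord_injective (n : ℕ) : Function.Injective (permWord n) := by
  intro σ τ h
  ext i
  have := List.map_inj_left.mp h i (List.mem_finRange i)
  omega

theorem exists_permWord_eq {n : ℕ} {s : List ℕ} (h : s.Perm (permWord n 1)) :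
    ∃ σ, permWord n σ = s := by
  have hlen : s.length = n := h.length_eq.trans (length_permWord n 1)
  have hnd : s.Nodup := h.nodup_iff.mpr (nodup_permWord n 1)
  have hmem : ∀ i (hi : i < s.length), 1 ≤ s[i] ∧ s[i] ≤ n := fun i hi =>
    mem_permWord.mp (h.subset (List.getElem_mem hi))
  let f : Fin n → Fin n := fun i => ⟨s[i.val]'(hlen ▸ i.isLt) - 1, by
    have := hmem i (hlen ▸ i.isLt); omega⟩
  have hf : Function.Injective f := by
    intro i j hij
    have h1 := hmem i (hlen ▸ i.isLt)
    have h2 := hmem j (hlen ▸ j.isLt)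
    have h3 : s[i.val]'(hlen ▸ i.isLt) - 1 = s[j.val]'(hlen ▸ j.isLt) - 1 := congrArg Fin.val hij
    exact Fin.ext ((hnd.getElem_inj_iff).mp (show s[i.val] = s[j.val] by omega))
  refine ⟨Equiv.ofBijective f (Finite.injective_iff_bijective.mp hf), ?_⟩
  apply List.ext_getElem (by simp [permWord, hlen])
  intro i h1 h2
  have := hmem i h2
  simp [permWord, f]
  omega

theorem count_afWord (n : ℕ) (σ : Equiv.Perm (Fin n)) : ∀ a ∈ afWord n σ,
    (afWord n σ).count a = 2 := by
  intro a ha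
  have h : a ∈ permWord n 1 ∧ a ∈ permWord n σ := by
    rw [afWord_eq, List.mem_append, mem_permWord, mem_permWord, or_self] at ha
    exact ⟨mem_permWord.mpr ha, mem_permWord.mpr ha⟩
  rw [afWord_eq, List.count_append, List.count_eq_one_of_mem (nodup_permWord n 1) h.1,
    List.count_eq_one_of_mem (nodup_permWord n σ) h.2]

theorem afWord_getD_left {n : ℕ} (σ : Equiv.Perm (Fin n)) (i : Fin n) :
    (afWord n σ).getD i 0 = i + 1 := by
  rw [afWord_eq, List.getD_append _ _ _ _ (by simp [length_permWord]),
    List.getD_eq_getElem _ _ (by simp [length_permWord])]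
  simp [permWord]

theorem afWord_getD_right {n : ℕ} (σ : Equiv.Perm (Fin n)) (j : Fin n) :
    (afWord n σ).getD (n + j) 0 = σ j + 1 := by
  rw [afWord_eq, List.getD_append_right _ _ _ _ (by simp [length_permWord]),
    List.getD_eq_getElem _ _ (by simp [length_permWord])]
  simp [permWord]

theorem mk_afWord_injective (n : ℕ) :
    Function.Injective fun σ : Equiv.Perm (Fin n) => (⟦afWord n σ⟧ : SockOrdering) := by
  intro σ τ h
  obtain ⟨-, he⟩ : SockEquiv (afWord n σ) (afWord n τ) := Quotient.exact h
  ext j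
  have hlen : (afWord n σ).length = n + n := by
    rw [afWord_eq, List.length_append, length_permWord, length_permWord]
  have := (he (σ j) (n + j) (by omega) (by omega)).mp
    (by rw [afWord_getD_left, afWord_getD_right])
  rw [afWord_getD_left, afWord_getD_right] at this
  omega

/-! ### Counting -/

theorem mem_layerings : ∀ {D S : List ℕ}, S ∈ layerings D ↔ LayeredBy D S
  | [], S => by
    simp only [layerings, Finset.mem_singleton]
    exact ⟨fun h => h ▸ .nil, fun h => by cases h; rfl⟩
  | [a], S => by
    simp only [layerings, Finset.mem_singleton]
    refine ⟨fun h => h ▸ .keep a .nil, fun h => ?_⟩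
    cases h with
    | keep _ h => cases h; rfl
  | a :: b :: D, S => by
    simp only [layerings, Finset.mem_union, Finset.mem_image, mem_layerings]
    constructor
    · rintro (⟨T, hT, rfl⟩ | ⟨T, hT, rfl⟩)
      · exact .keep a hT
      · exact .swap a b hT
    · intro h
      cases h with
      | keep _ h => exact .inl ⟨_, h, rfl⟩
      | swap _ _ h => exact .inr ⟨_, h, rfl⟩

theorem card_layerings : ∀ {D : List ℕ}, D.Nodup →
    (layerings D).card = Nat.fib (D.length + 1)
  | [], _ => by simp [layerings]
  | [a], _ => by simp [layerings]
  | a :: b :: D, h => by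
    have hab : a ≠ b := fun hh => by simp [hh] at h
    have h1 := (List.nodup_cons.mp h).2
    rw [layerings, Finset.card_union_of_disjoint, Finset.card_image_of_injective _
      List.cons_injective, Finset.card_image_of_injective _ fun _ _ hh => by simpa using hh,
      card_layerings h1, card_layerings (List.nodup_cons.mp h1).2]
    · simp only [List.length_cons]
      rw [Nat.fib_add_two (n := D.length + 1)]
      ring
    · rw [Finset.disjoint_left]
      simp only [Finset.mem_image, not_exists, not_and]
      rintro _ ⟨T, -, rfl⟩ T' - hT
      exact hab (List.cons.inj hT).1.symm

/-- Good words in which the color that is emitted first opens the second half. -/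
def goodFirst (E : List ℕ) : Finset (List ℕ) :=
  E.toFinset.biUnion fun a => (layerings (E.erase a)).image (List.cons a)

/-- Good words in which the color that is emitted first comes second in the second half. -/
def goodSecond (E : List ℕ) : Finset (List ℕ) :=
  E.toFinset.biUnion fun a =>
    (layerings (E.erase a).tail).image fun S => (E.erase a).headD 0 :: a :: S

theorem mem_goodFirst {E s : List ℕ} :
    s ∈ goodFirst E ↔ ∃ a ∈ E, ∃ s', s = a :: s' ∧ LayeredBy (E.erase a) s' := by
  simp only [goodFirst, Finset.mem_biUnion, List.mem_toFinset, Finset.mem_image, mem_layerings]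
  exact exists_congr fun a => and_congr_right fun _ => exists_congr fun s' => by
    rw [and_comm, eq_comm]

theorem mem_goodSecond {E s : List ℕ} (hE : 2 ≤ E.length) :
    s ∈ goodSecond E ↔
      ∃ a ∈ E, ∃ x F' s', E.erase a = x :: F' ∧ s = x :: a :: s' ∧ LayeredBy F' s' := by
  simp only [goodSecond, Finset.mem_biUnion, List.mem_toFinset, Finset.mem_image, mem_layerings]
  refine exists_congr fun a => and_congr_right fun ha => ?_
  have hlen := List.length_erase_of_mem ha
  obtain ⟨x, F, hF⟩ := List.exists_cons_of_length_pos (l := E.erase a) (by omega)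
  simp only [hF, List.tail_cons, List.headD_cons]
  constructor
  · rintro ⟨s', h, rfl⟩
    exact ⟨x, F, s', rfl, rfl, h⟩
  · rintro ⟨_, _, s', h, rfl, hl⟩
    obtain ⟨rfl, rfl⟩ := List.cons.inj h
    exact ⟨s', hl, rfl⟩

theorem card_goodFirst {E : List ℕ} (hE : E.Nodup) :
    (goodFirst E).card = E.length * Nat.fib E.length := by
  rw [goodFirst, Finset.card_biUnion]
  · rw [Finset.sum_congr rfl (g := fun _ => Nat.fib E.length), Finset.sum_const,
      List.toFinset_card_of_nodup hE, smul_eq_mul]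
    intro a ha
    have ha := List.mem_toFinset.mp ha
    have := List.length_pos_of_mem ha
    rw [Finset.card_image_of_injective _ List.cons_injective, card_layerings (hE.erase a),
      List.length_erase_of_mem ha, Nat.sub_add_cancel this]
  · intro a _ b _ hab
    rw [Function.onFun, Finset.disjoint_left]
    simp only [Finset.mem_image, not_exists, not_and]
    rintro _ ⟨T, -, rfl⟩ T' - hT
    exact hab (List.cons.inj hT).1.symm

theorem card_goodSecond {E : List ℕ} (hE : E.Nodup) (hlen : 2 ≤ E.length) :
    (goodSecond E).card = E.length * Nat.fib (E.length - 1) := by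
  rw [goodSecond, Finset.card_biUnion]
  · rw [Finset.sum_congr rfl (g := fun _ => Nat.fib (E.length - 1)), Finset.sum_const,
      List.toFinset_card_of_nodup hE, smul_eq_mul]
    intro a ha
    have ha := List.mem_toFinset.mp ha
    rw [Finset.card_image_of_injective _ fun _ _ hh => by simpa using hh,
      card_layerings (hE.erase a).tail, List.length_tail, List.length_erase_of_mem ha]
    congr 1
    omega
  · intro a _ b _ hab
    rw [Function.onFun, Finset.disjoint_left]
    simp only [Finset.mem_image, not_exists, not_and]
    rintro _ ⟨T, -, rfl⟩ T' - hT
    simp only [List.cons.injEq] at hT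
    exact hab hT.2.1.symm

/-- The words starting with the first and third entries of `p :: q :: R` that are good in
both ways. -/
def goodBothThird (p q : ℕ) : List ℕ → Finset (List ℕ)
  | [] => ∅
  | r :: R => (layerings R).image fun S => p :: r :: q :: S

theorem goodFirst_inter_goodSecond {p q : ℕ} {R : List ℕ} (hE : (p :: q :: R).Nodup) :
    goodFirst (p :: q :: R) ∩ goodSecond (p :: q :: R) =
      ((layerings R).image fun S => p :: q :: S) ∪ ((layerings R).image fun S => q :: p :: S) ∪
        goodBothThird p q R := by
  have hpq : p ≠ q := fun hh => by simp [hh] at hE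
  ext s
  rw [Finset.mem_inter, mem_goodFirst, mem_goodSecond (by simp), Finset.mem_union,
    Finset.mem_union, Finset.mem_image, Finset.mem_image]
  simp only [mem_layerings]
  constructor
  · rintro ⟨⟨a, -, s', rfl, h1⟩, b, -, x, F', s'', hF, hs, h2⟩
    obtain ⟨rfl, rfl⟩ := List.cons.inj hs
    by_cases hbp : b = p
    · subst hbp
      rw [List.erase_cons_head] at hF
      obtain ⟨rfl, rfl⟩ := List.cons.inj hF
      exact .inl (.inr ⟨s'', h2, rfl⟩)
    · rw [List.erase_cons_tail (by simpa using Ne.symm hbp)] at hF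
      obtain ⟨rfl, hF⟩ := List.cons.inj hF
      rw [List.erase_cons_head] at h1
      cases h1 with
      | keep _ h1 => exact .inl (.inl ⟨s'', h1, rfl⟩)
      | @swap _ _ R' S h1 =>
        refine .inr ?_
        rw [goodBothThird, Finset.mem_image]
        exact ⟨S, mem_layerings.mpr h1, rfl⟩
  · rintro ((⟨S, h, rfl⟩ | ⟨S, h, rfl⟩) | h)
    · refine ⟨⟨p, by simp, q :: S, rfl, ?_⟩, q, by simp, p, R, S, ?_, rfl, h⟩
      · simpa using h.keep q
      · rw [List.erase_cons_tail (by simpa using hpq), List.erase_cons_head]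
    · refine ⟨⟨q, by simp, p :: S, rfl, ?_⟩, p, by simp, q, R, S, by simp, rfl, h⟩
      rw [List.erase_cons_tail (by simpa using hpq), List.erase_cons_head]
      exact h.keep p
    · cases R with
      | nil => simp [goodBothThird] at h
      | cons r R =>
        rw [goodBothThird, Finset.mem_image] at h
        obtain ⟨S, h, rfl⟩ := h
        rw [mem_layerings] at h
        have hpr : p ≠ r := fun hh => by simp [hh] at hE
        have hqr : q ≠ r := fun hh => by simp [hh] at hE
        refine ⟨⟨p, by simp, r :: q :: S, rfl, ?_⟩, r, by simp, p, q :: R, q :: S, ?_, rfl,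
          h.keep q⟩
        · simpa using h.swap q r
        · rw [List.erase_cons_tail (by simpa using hpr),
            List.erase_cons_tail (by simpa using hqr), List.erase_cons_head]

theorem card_goodBothThird {p q : ℕ} {R : List ℕ} (hR : R.Nodup) :
    (goodBothThird p q R).card = Nat.fib R.length := by
  cases R with
  | nil => rfl
  | cons r R =>
    rw [goodBothThird, Finset.card_image_of_injective _ fun _ _ hh => by simpa using hh,
      card_layerings (List.nodup_cons.mp hR).2, List.length_cons]

theorem card_goodFirst_inter_goodSecond {p q : ℕ} {R : List ℕ} (hE : (p :: q :: R).Nodup) :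
    (goodFirst (p :: q :: R) ∩ goodSecond (p :: q :: R)).card = Nat.fib (R.length + 3) := by
  have hpq : p ≠ q := fun hh => by simp [hh] at hE
  have hR : R.Nodup := (List.nodup_cons.mp (List.nodup_cons.mp hE).2).2
  rw [goodFirst_inter_goodSecond hE, Finset.card_union_of_disjoint, Finset.card_union_of_disjoint,
    Finset.card_image_of_injective _ fun _ _ hh => by simpa using hh,
    Finset.card_image_of_injective _ fun _ _ hh => by simpa using hh,
    card_layerings hR, card_goodBothThird hR]
  · rw [Nat.fib_add_two (n := R.length + 1), Nat.fib_add_two (n := R.length)]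
    ring
  · rw [Finset.disjoint_left]
    simp only [Finset.mem_image, not_exists, not_and]
    rintro _ ⟨T, -, rfl⟩ T' - hT
    exact hpq (List.cons.inj hT).1.symm
  · rw [Finset.disjoint_left]
    cases R with
    | nil => simp [goodBothThird]
    | cons r R =>
      have hqr : q ≠ r := fun hh => by simp [hh] at hE
      simp only [goodBothThird, Finset.mem_union, Finset.mem_image, not_exists, not_and]
      rintro _ (⟨T, -, rfl⟩ | ⟨T, -, rfl⟩) T' - hT <;> simp only [List.cons.injEq] at hT
      · exact hqr hT.2.1.symm
      · exact hpq hT.1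

theorem ncard_goodWord {E : List ℕ} (hE : E.Nodup) (hlen : 2 ≤ E.length) :
    {s | GoodWord E s}.ncard = (E.length - 1) * Nat.fib (E.length + 1) := by
  have hset : {s | GoodWord E s} = ↑(goodFirst E ∪ goodSecond E) := by
    ext s
    rw [Finset.mem_coe, Finset.mem_union, mem_goodFirst, mem_goodSecond hlen]
    simp only [GoodWord, Set.mem_ofPred_eq, and_or_left, exists_or]
  rw [hset, Set.ncard_coe_finset]
  have h := Finset.card_union_add_card_inter (goodFirst E) (goodSecond E)
  rw [card_goodFirst hE, card_goodSecond hE hlen] at h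
  match E, hE, hlen with
  | p :: q :: R, hE, _ =>
    rw [card_goodFirst_inter_goodSecond hE] at h
    simp only [List.length_cons, Nat.add_sub_cancel] at h ⊢
    have h1 : Nat.fib (R.length + 3) = Nat.fib (R.length + 1) + Nat.fib (R.length + 2) :=
      Nat.fib_add_two
    have h2 : R.length + 1 + 1 + 1 = R.length + 3 := rfl
    have h3 : R.length + 1 + 1 = R.length + 2 := rfl
    rw [h2, h1]
    rw [h3, h1] at h
    nlinarith

/-- there are exactly `(n-1) * F (n+1)` foot-sortable alignment-free 2-uniform
sock orderings of length `2n`. -/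
theorem count_footSortable_alignmentFree (n : ℕ) (hn : 2 ≤ n) :
    {ρ : SockOrdering | (∃ σ : Equiv.Perm (Fin n), (⟦afWord n σ⟧ : SockOrdering) = ρ) ∧
        FootSortable 1 ρ}.ncard = (n - 1) * Nat.fib (n + 1) := by
  set E := (permWord n 1).reverse with hE
  have hnd : E.Nodup := List.nodup_reverse.mpr (nodup_permWord n 1)
  have hlen : E.length = n := by rw [hE, List.length_reverse, length_permWord]
  have hiff : ∀ σ, FootSortable 1 (⟦afWord n σ⟧ : SockOrdering) ↔ GoodWord E (permWord n σ) := by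
    intro σ
    rw [footSortable_one_iff_pairSortable (count_afWord n σ),
      ← pairSortable_iff_goodWord hnd (List.ne_nil_of_length_pos (by omega))
        ((permWord_perm n σ 1).trans (List.reverse_perm _).symm), hE, List.reverse_reverse,
      afWord_eq]
  have hρ : {ρ : SockOrdering | (∃ σ : Equiv.Perm (Fin n), (⟦afWord n σ⟧ : SockOrdering) = ρ) ∧
      FootSortable 1 ρ} = (fun σ : Equiv.Perm (Fin n) => (⟦afWord n σ⟧ : SockOrdering)) ''
        {σ | GoodWord E (permWord n σ)} := by
    ext ρ
    constructor
    · rintro ⟨⟨σ, rfl⟩, h⟩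
      exact ⟨σ, (hiff σ).mp h, rfl⟩
    · rintro ⟨σ, h, rfl⟩
      exact ⟨⟨σ, rfl⟩, (hiff σ).mpr h⟩
  have hs : {s | GoodWord E s} = permWord n '' {σ | GoodWord E (permWord n σ)} := by
    ext s
    constructor
    · intro h
      obtain ⟨σ, rfl⟩ := exists_permWord_eq (GoodWord.perm h |>.trans (List.reverse_perm _))
      exact ⟨σ, h, rfl⟩
    · rintro ⟨σ, h, rfl⟩
      exact h
  have hcard := ncard_goodWord hnd (by omega)
  rw [hs, Set.ncard_image_of_injective _ (permWord_injective n), hlen] at hcard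
  rw [hρ]
  exact (Set.ncard_image_of_injective _ (mk_afWord_injective n)).trans hcard
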